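/- Every finite abelian group G containing no element of order 4 (equivalently, containing no subgroup isomorphic to the cyclic group ℤ/4ℤ) is a natural group. -/

import Mathlib

/-- A group structure `s` on `X` is compatible with the metric `m`: all left translations,
right translations, and the inversion are isometries. -/
def Compatible {X : Type*} (m : MetricSpace X) (s : Group X) : Prop :=
  (∀ g x y : X, m.dist (s.mul g x) (s.mul g y) = m.dist x y) ∧
  (∀ g x y : X, m.dist (s.mul x g) (s.mul y g) = m.dist x y) ∧
  (∀ x y : X, m.dist (s.inv x) (s.inv y) = m.dist x y)

/-- Two group structures are isomorphic as groups. -/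
def GroupStructIso {X Y : Type*} (s : Group X) (t : Group Y) : Prop :=
  ∃ f : X ≃ Y, ∀ a b : X, f (s.mul a b) = t.mul (f a) (f b)

/-- A group `G` is natural if there is a metric on its underlying set with which its group
structure is compatible such that every group structure compatible with this metric is
isomorphic to `G`. -/
def NaturalGroup (G : Type*) [grp : Group G] : Prop :=
  ∃ m : MetricSpace G,
    Compatible m grp ∧ ∀ s : Group G, Compatible m s → GroupStructIso s grp

theorem exists_norm_aux (G : Type*) [CommGroup G] [Finite G] :
    ∃ N : G → ℝ, N 1 = 0 ∧ (∀ g, g ≠ 1 → 1 ≤ N g ∧ N g ≤ 2) ∧ (∀ g, N g⁻¹ = N g) ∧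
      ∀ g k, N g = N k → g = k ∨ g = k⁻¹ := by
  classical
  obtain ⟨φ, hφ⟩ := Countable.exists_injective_nat G
  have hb : ∀ n : ℕ, 0 < (1 : ℝ) / (1 + (n : ℝ)) ∧ (1 : ℝ) / (1 + (n : ℝ)) ≤ 1 := by
    intro n
    have hn : (0 : ℝ) ≤ n := Nat.cast_nonneg n
    refine ⟨by positivity, ?_⟩
    rw [div_le_one (by positivity)]
    linarith
  refine ⟨fun g => if g = 1 then 0 else 1 + 1 / (1 + ((min (φ g) (φ g⁻¹) : ℕ) : ℝ)),
    by simp, ?_, ?_, ?_⟩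
  · intro g hg
    have := hb (min (φ g) (φ g⁻¹))
    simp only [hg, if_false]
    constructor <;> linarith [this.1, this.2]
  · intro g
    simp only [inv_eq_one, inv_inv, min_comm]
  · intro g k hgk
    have hg := hb (min (φ g) (φ g⁻¹))
    have hk := hb (min (φ k) (φ k⁻¹))
    by_cases h1 : g = 1 <;> by_cases h2 : k = 1
    · left; rw [h1, h2]
    · simp only [h1, h2, if_true, if_false] at hgk
      linarith [hk.1]
    · simp only [h1, h2, if_true, if_false] at hgk
      linarith [hg.1]
    · simp only [h1, h2, if_false] at hgk
      have h3 : min (φ g) (φ g⁻¹) = min (φ k) (φ k⁻¹) := by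
        have h4 := add_left_cancel hgk
        rw [one_div, one_div] at h4
        have h5 := add_left_cancel (inv_injective h4)
        exact_mod_cast h5
      rcases min_choice (φ g) (φ g⁻¹) with a | a <;> rcases min_choice (φ k) (φ k⁻¹) with b | b <;>
        rw [a, b] at h3 <;> have h6 := hφ h3
      · exact Or.inl h6
      · exact Or.inr h6
      · right; rw [← h6, inv_inv]
      · left; exact inv_injective h6

/-- Maps fixing `1` and preserving quotients up to inversion are the identity or the inversion. -/
theorem id_or_inv_aux {G : Type*} [CommGroup G] (f : G → G) (h1 : f 1 = 1)
    (hf : ∀ x y, f x * (f y)⁻¹ = x * y⁻¹ ∨ f x * (f y)⁻¹ = (x * y⁻¹)⁻¹) :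
    (∀ x, f x = x) ∨ (∀ x, f x = x⁻¹) := by
  have hp : ∀ x, f x = x ∨ f x = x⁻¹ := by
    intro x
    simpa [h1] using hf x 1
  by_contra hc
  push Not at hc
  obtain ⟨⟨y, hy⟩, ⟨x, hx⟩⟩ := hc
  have hx' := (hp x).resolve_right hx
  have hy' := (hp y).resolve_left hy
  rw [hx'] at hx
  rw [hy'] at hy
  have := hf x y
  rw [hx', hy', inv_inv] at this
  rcases this with e | e
  · exact hy (mul_left_cancel e).symm
  · apply hx
    rw [mul_inv, inv_inv] at e
    exact mul_right_cancel e

theorem op_core_aux {G : Type*} [CommGroup G] (h : ∀ g : G, orderOf g ≠ 4) (N : G → ℝ)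
    (Ninj : ∀ g k, N g = N k → g = k ∨ g = k⁻¹) (op : G → G → G) (e : G)
    (he1 : ∀ g, op g e = g) (he2 : ∀ g, op e g = g)
    (hl' : ∀ g x y : G, N (op g x * (op g y)⁻¹) = N (x * y⁻¹))
    (hr' : ∀ g x y : G, N (op x g * (op y g)⁻¹) = N (x * y⁻¹)) :
    ∃ f : G ≃ G, ∀ a b : G, f (op a b) = f a * f b := by
  have L : ∀ g, (∀ x, op g (x * e) * g⁻¹ = x) ∨ (∀ x, op g (x * e) * g⁻¹ = x⁻¹) := by
    intro g
    apply id_or_inv_aux (fun x => op g (x * e) * g⁻¹)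
    · simp [he1]
    · intro x y
      apply Ninj
      have := hl' g (x * e) (y * e)
      simpa using this
  have R : ∀ g, (∀ x, op (x * e) g * g⁻¹ = x) ∨ (∀ x, op (x * e) g * g⁻¹ = x⁻¹) := by
    intro g
    apply id_or_inv_aux (fun x => op (x * e) g * g⁻¹)
    · simp [he2]
    · intro x y
      apply Ninj
      have := hr' g (x * e) (y * e)
      simpa using this
  have key : ∀ g x, op g (x * e) * g⁻¹ = x := by
    intro g
    rcases L g with H | H
    · exact H
    obtain ⟨u, rfl⟩ : ∃ u, g = u * e := ⟨g * e⁻¹, by simp⟩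
    have sq : ∀ x : G, x ^ 2 = 1 ∨ u ^ 2 = x ^ 2 := by
      intro x
      have a := H x
      rw [mul_inv_eq_iff_eq_mul] at a
      rcases R (x * e) with H' | H' <;> have b := H' u <;> rw [a, mul_inv_eq_iff_eq_mul] at b
      · left
        have c : x⁻¹ * (u * e) = x * (u * e) := by rw [b]; exact mul_left_comm _ _ _
        have c := mul_right_cancel c
        rw [pow_two]
        nth_rewrite 1 [← c]
        simp
      · right
        rw [← mul_assoc, ← mul_assoc] at b
        have c := mul_right_cancel b
        rw [inv_mul_eq_iff_eq_mul] at c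
        calc u ^ 2 = u * u := pow_two u
          _ = u * (x * (u⁻¹ * x)) := by rw [← c]
          _ = x ^ 2 := by rw [mul_left_comm, mul_inv_cancel_left, pow_two]
    have all : ∀ x : G, x ^ 2 = 1 := by
      intro x
      by_contra hx
      have h2 := (sq x).resolve_left hx
      have hu : u ^ 2 ≠ 1 := by rwa [h2]
      have h4 : u ^ 4 = 1 := by
        rcases sq (u ^ 2) with k | k
        · rw [← k, ← pow_mul]
        · exfalso; apply hu
          rw [pow_two (u ^ 2)] at k
          exact (left_eq_mul.mp k)
      exact h u (orderOf_eq_prime_pow (p := 2) (n := 1) (by simpa using hu) (by simpa using h4))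
    intro x
    rw [H x, inv_eq_iff_mul_eq_one, ← pow_two, all]
  refine ⟨Equiv.mulRight e⁻¹, fun a b => ?_⟩
  simp only [Equiv.coe_mulRight]
  have k := key a (b * e⁻¹)
  rw [inv_mul_cancel_right, mul_inv_eq_iff_eq_mul] at k
  rw [k, mul_comm (b * e⁻¹) a, ← mul_assoc, ← mul_assoc, mul_right_comm a b e⁻¹]

/-- Every finite abelian group containing no element of order 4 (equivalently, no subgroup
isomorphic to ℤ/4ℤ) is a natural group. -/
theorem naturalGroup_of_finite_comm_no_order_four (G : Type*) [CommGroup G] [Finite G]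
    (h : ∀ g : G, orderOf g ≠ 4) : NaturalGroup G := by
  obtain ⟨N, N1, Nb, Ninv, Ninj⟩ := exists_norm_aux G
  have Npos : ∀ g, 0 ≤ N g := by
    intro g
    by_cases hg : g = 1
    · rw [hg, N1]
    · linarith [(Nb g hg).1]
  have Nle : ∀ g, N g ≤ 2 := by
    intro g
    by_cases hg : g = 1
    · rw [hg, N1]; norm_num
    · exact (Nb g hg).2
  let m : MetricSpace G :=
    { dist := fun x y => N (x * y⁻¹)
      dist_self := fun x => by simp [N1]
      dist_comm := fun x y => by
        show N (x * y⁻¹) = N (y * x⁻¹)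
        rw [← Ninv (x * y⁻¹)]; congr 1; group
      dist_triangle := fun x y z => by
        show N (x * z⁻¹) ≤ N (x * y⁻¹) + N (y * z⁻¹)
        by_cases hxy : x = y
        · subst hxy; simp [N1]
        by_cases hyz : y = z
        · subst hyz; simp [N1]
        have a := (Nb (x * y⁻¹) (by rwa [Ne, mul_inv_eq_one])).1
        have b := (Nb (y * z⁻¹) (by rwa [Ne, mul_inv_eq_one])).1
        linarith [Nle (x * z⁻¹)]
      eq_of_dist_eq_zero := fun {x y} hxy => by
        change N (x * y⁻¹) = 0 at hxy
        by_contra hne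
        have a := (Nb (x * y⁻¹) (by rwa [Ne, mul_inv_eq_one])).1
        linarith }
  refine ⟨m, ⟨?_, ?_, ?_⟩, ?_⟩
  · intro g x y
    show N ((g * x) * (g * y)⁻¹) = N (x * y⁻¹)
    congr 1
    rw [mul_inv, mul_mul_mul_comm, mul_inv_cancel, one_mul]
  · intro g x y
    show N ((x * g) * (y * g)⁻¹) = N (x * y⁻¹)
    congr 1
    group
  · intro x y
    show N (x⁻¹ * (y⁻¹)⁻¹) = N (x * y⁻¹)
    rw [← Ninv (x * y⁻¹), mul_inv]
  · rintro s ⟨hl, hr, -⟩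
    exact op_core_aux h N Ninj s.mul s.one s.mul_one s.one_mul hl hr
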